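/- Suppose F ∈ 𝓔^m has the form F(Σ) = tr(φ(Σ)) on S^m_+ with φ analytic on (0,+∞), and that 𝕃^m_+ = ∇F(S^m_+) is open. Let 𝓛 ⊆ S^m be a linear subspace that is a Jordan algebra ((AB+BA)/2 ∈ 𝓛 for all A,B ∈ 𝓛) containing the identity matrix I_m, and let S_n ∈ S^m. If the orthogonal projection Σ̂ of S_n onto 𝓛 (with respect to the trace inner product) is positive definite, then L̂ := ∇F(Σ̂) is the unique maximizer of g_n(L) := −F*(L) + ⟨L, S_n⟩ over 𝓛 ∩ 𝕃^m_+. -/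

import Mathlib

open Matrix Filter Topology

namespace Entropic

abbrev Mat (m : ℕ) := Matrix (Fin m) (Fin m) ℝ

variable {m : ℕ}

/-- The trace inner product `⟨A,B⟩ = tr(AB)` on matrices. -/
noncomputable def ip (A B : Mat m) : ℝ := (A * B).trace

/-- The Frobenius norm `‖A‖_F = √tr(AAᵀ)`. -/
noncomputable def fnorm (A : Mat m) : ℝ := Real.sqrt (ip A Aᵀ)

/-- The class `𝓔^m`: proper convex lower semicontinuous `F : S^m → ℝ ∪ {+∞}` with
`S^m_+ ⊆ dom F ⊆ cl(S^m_+)` which is strictly convex and continuously differentiable on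
`S^m_+`; the (trace-inner-product) gradient on `S^m_+` is bundled as `grad`. -/
structure EClass (m : ℕ) where
  F : Mat m → EReal
  grad : Mat m → Mat m
  F_ne_bot : ∀ A : Mat m, F A ≠ ⊥
  convex : ∀ x y : Mat m, x.IsHermitian → y.IsHermitian → ∀ a b : ℝ,
    0 ≤ a → 0 ≤ b → a + b = 1 →
    F (a • x + b • y) ≤ (a : EReal) * F x + (b : EReal) * F y
  lsc : LowerSemicontinuousOn F {A : Mat m | A.IsHermitian}
  posDef_mem_dom : ∀ A : Mat m, A.PosDef → F A ≠ ⊤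
  dom_subset_psd : ∀ A : Mat m, F A ≠ ⊤ → A.PosSemidef
  strictConvex : ∀ x y : Mat m, x.PosDef → y.PosDef → x ≠ y → ∀ a b : ℝ,
    0 < a → 0 < b → a + b = 1 →
    F (a • x + b • y) < (a : EReal) * F x + (b : EReal) * F y
  grad_isHermitian : ∀ P : Mat m, P.PosDef → (grad P).IsHermitian
  hasGradAt : ∀ P : Mat m, P.PosDef → ∀ H : Mat m, H.IsHermitian →
    HasDerivAt (fun t : ℝ => (F (P + t • H)).toReal) (ip (grad P) H) 0
  grad_continuousOn : ContinuousOn grad {A : Mat m | A.PosDef}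

/-- `𝕃^m_+ = ∇F(S^m_+)`. -/
def Lplus (E : EClass m) : Set (Mat m) := E.grad '' {A : Mat m | A.PosDef}

/-- The Fenchel conjugate `F*(L) = sup_{Σ ∈ S^m} (⟨Σ,L⟩ − F(Σ))`. -/
noncomputable def conj (E : EClass m) (L : Mat m) : EReal :=
  ⨆ S : {A : Mat m // A.IsHermitian}, ((ip (S : Mat m) L : EReal) - E.F (S : Mat m))

/-- `g_n(L) = −F*(L) + ⟨L, S_n⟩`. -/
noncomputable def gn (E : EClass m) (Sn L : Mat m) : EReal :=
  -(conj E L) + (ip L Sn : EReal)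

/-- A set `U ⊆ S^m` is (relatively) open in `S^m`. -/
def RelOpen (U : Set (Mat m)) : Prop :=
  U ⊆ {A : Mat m | A.IsHermitian} ∧
    ∀ L ∈ U, ∃ ε > 0, ∀ M : Mat m, M.IsHermitian → fnorm (M - L) < ε → M ∈ U

/-- The affine subspace `A₀ + V` of `S^m`. -/
def affSet (A0 : Mat m) (V : Submodule ℝ (Mat m)) : Set (Mat m) :=
  {L : Mat m | L - A0 ∈ V}

/-- The orthogonal complement in `S^m` (w.r.t. the trace inner product) of the linear
subspace `V`. -/
def perp (V : Submodule ℝ (Mat m)) : Set (Mat m) :=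
  {W : Mat m | W.IsHermitian ∧ ∀ U ∈ V, ip W U = 0}


/-- The matrix function `ψ(Σ) = U ψ(Λ) Uᵀ` obtained by applying `ψ : ℝ → ℝ` to the
eigenvalues in a spectral decomposition of a symmetric matrix. -/
noncomputable def matApply {m : ℕ} (ψ : ℝ → ℝ) (P : Mat m) : Mat m :=
  if h : P.IsHermitian then
    (h.eigenvectorUnitary : Mat m) * Matrix.diagonal (fun i => ψ (h.eigenvalues i)) *
      star (h.eigenvectorUnitary : Mat m)
  else 0

lemma matApply_eq_cfc (ψ : ℝ → ℝ) {P : Mat m} (hP : P.IsHermitian) :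
    matApply ψ P = cfc ψ P := by
  rw [hP.cfc_eq, Matrix.IsHermitian.cfc, Unitary.conjStarAlgAut_apply, matApply, dif_pos hP]
  rfl

/-- A function of a symmetric matrix is a polynomial in that matrix. -/
lemma exists_matApply_eq_aeval (ψ : ℝ → ℝ) {P : Mat m} (hP : P.IsHermitian) :
    ∃ p : Polynomial ℝ, matApply ψ P = Polynomial.aeval P p := by
  have hs : IsSelfAdjoint P := hP
  let s := P.finite_real_spectrum.toFinset
  refine ⟨Lagrange.interpolate s id ψ, ?_⟩
  rw [matApply_eq_cfc ψ hP, ← cfc_polynomial _ P hs]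
  refine cfc_congr fun x hx => ?_
  exact (Lagrange.eval_interpolate_at_node ψ (Function.injective_id.injOn)
    (P.finite_real_spectrum.mem_toFinset.mpr hx)).symm

/-- A unital Jordan subalgebra is closed under evaluating polynomials. -/
lemma aeval_mem_of_jordan {L : Submodule ℝ (Mat m)}
    (hJordan : ∀ A B : Mat m, A ∈ L → B ∈ L → ((1 : ℝ) / 2) • (A * B + B * A) ∈ L)
    (hI : (1 : Mat m) ∈ L) {P : Mat m} (hP : P ∈ L) (p : Polynomial ℝ) :
    Polynomial.aeval P p ∈ L := by
  have hpow : ∀ n : ℕ, P ^ n ∈ L := by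
    intro n
    induction n with
    | zero => simpa using hI
    | succ n ih =>
      have h := hJordan _ _ ih hP
      rwa [← pow_succ, ← pow_succ', ← two_smul ℝ, smul_smul, one_div,
        inv_mul_cancel₀ two_ne_zero, one_smul] at h
  rw [Polynomial.aeval_eq_sum_range]
  exact L.sum_mem fun i _ => L.smul_mem _ (hpow i)

lemma ip_comm (A B : Mat m) : ip A B = ip B A := Matrix.trace_mul_comm A B

lemma ip_sub_left (A B C : Mat m) : ip (A - B) C = ip A C - ip B C := by
  simp [ip, sub_mul]

lemma ip_sub_right (A B C : Mat m) : ip A (B - C) = ip A B - ip A C := by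
  simp [ip, mul_sub]

lemma ip_smul_right (A B : Mat m) (c : ℝ) : ip A (c • B) = c * ip A B := by
  simp [ip]

namespace EClass

lemma coe_toReal_F (E : EClass m) {A : Mat m} (hA : E.F A ≠ ⊤) :
    ((E.F A).toReal : EReal) = E.F A :=
  EReal.coe_toReal hA (E.F_ne_bot A)

lemma toReal_F_convex (E : EClass m) {x y : Mat m} (hx : x.IsHermitian) (hy : y.IsHermitian)
    (hFx : E.F x ≠ ⊤) (hFy : E.F y ≠ ⊤) {a b : ℝ} (ha : 0 ≤ a) (hb : 0 ≤ b) (hab : a + b = 1) :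
    (E.F (a • x + b • y)).toReal ≤ a * (E.F x).toReal + b * (E.F y).toReal := by
  have h := E.convex x y hx hy a b ha hb hab
  rw [← E.coe_toReal_F hFx, ← E.coe_toReal_F hFy] at h
  have h' : E.F (a • x + b • y) ≤
      ((a * (E.F x).toReal + b * (E.F y).toReal : ℝ) : EReal) := by exact_mod_cast h
  have := EReal.toReal_le_toReal h' (E.F_ne_bot _) (EReal.coe_ne_top _)
  rwa [EReal.toReal_coe] at this

lemma toReal_F_strictConvex (E : EClass m) {x y : Mat m} (hx : x.PosDef) (hy : y.PosDef)
    (hxy : x ≠ y) {a b : ℝ} (ha : 0 < a) (hb : 0 < b) (hab : a + b = 1) :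
    (E.F (a • x + b • y)).toReal < a * (E.F x).toReal + b * (E.F y).toReal := by
  have h := E.strictConvex x y hx hy hxy a b ha hb hab
  rw [← E.coe_toReal_F (E.posDef_mem_dom _ hx), ← E.coe_toReal_F (E.posDef_mem_dom _ hy)] at h
  have h' : E.F (a • x + b • y) <
      ((a * (E.F x).toReal + b * (E.F y).toReal : ℝ) : EReal) := by exact_mod_cast h
  rw [← E.coe_toReal_F h'.ne_top] at h'
  exact_mod_cast h'

/-- The gradient inequality for the convex function `F`. -/
lemma add_ip_grad_le (E : EClass m) {P S : Mat m} (hP : P.PosDef) (hS : S.IsHermitian)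
    (hFS : E.F S ≠ ⊤) :
    (E.F P).toReal + ip (E.grad P) (S - P) ≤ (E.F S).toReal := by
  have hd := (E.hasGradAt P hP (S - P) (hS.sub hP.isHermitian)).tendsto_slope_zero_right
  suffices ip (E.grad P) (S - P) ≤ (E.F S).toReal - (E.F P).toReal by linarith
  refine le_of_tendsto hd ?_
  filter_upwards [Ioo_mem_nhdsGT (zero_lt_one (α := ℝ))] with t ht
  have hc := E.toReal_F_convex hP.isHermitian hS (E.posDef_mem_dom P hP) hFS
    (sub_nonneg.mpr ht.2.le) ht.1.le (sub_add_cancel 1 t)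
  have he : P + t • (S - P) = (1 - t) • P + t • S := by
    rw [smul_sub, sub_smul, one_smul]; abel
  simp only [zero_add, zero_smul, add_zero, smul_eq_mul, he]
  rw [inv_mul_le_iff₀ ht.1]
  linarith

lemma add_ip_grad_lt (E : EClass m) {P S : Mat m} (hP : P.PosDef) (hS : S.PosDef)
    (hPS : P ≠ S) :
    (E.F P).toReal + ip (E.grad P) (S - P) < (E.F S).toReal := by
  have hhalf : (0 : ℝ) < 1 / 2 := by norm_num
  have hM : ((1 / 2 : ℝ) • P + (1 / 2 : ℝ) • S).PosDef := (hP.smul hhalf).add (hS.smul hhalf)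
  have h₁ := E.add_ip_grad_le hP hM.isHermitian (E.posDef_mem_dom _ hM)
  have h₂ := E.toReal_F_strictConvex hP hS hPS hhalf hhalf (by norm_num)
  have he : (1 / 2 : ℝ) • P + (1 / 2 : ℝ) • S - P = (1 / 2 : ℝ) • (S - P) := by
    module
  rw [he, ip_smul_right] at h₁
  linarith

/-- The Fenchel equality at a gradient. -/
lemma conj_grad (E : EClass m) {P : Mat m} (hP : P.PosDef) :
    conj E (E.grad P) = ((ip P (E.grad P) - (E.F P).toReal : ℝ) : EReal) := by
  refine le_antisymm (iSup_le fun S => ?_) ?_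
  · by_cases hS : E.F S = ⊤
    · rw [hS, EReal.sub_top]
      exact bot_le
    · have h := E.add_ip_grad_le hP S.2 hS
      rw [ip_sub_right, ip_comm _ P, ip_comm _ (S : Mat m)] at h
      rw [← E.coe_toReal_F hS, ← EReal.coe_sub]
      exact EReal.coe_le_coe (by linarith)
  · refine le_trans (le_of_eq ?_) (le_iSup _ (⟨P, hP.isHermitian⟩ : {A : Mat m // A.IsHermitian}))
    rw [EReal.coe_sub, E.coe_toReal_F (E.posDef_mem_dom P hP)]

lemma gn_grad (E : EClass m) {P Sn Shat : Mat m} (hP : P.PosDef)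
    (h : ip (Sn - Shat) (E.grad P) = 0) :
    gn E Sn (E.grad P) = (((E.F P).toReal + ip (E.grad P) (Shat - P) : ℝ) : EReal) := by
  rw [gn, E.conj_grad hP, ← EReal.coe_neg, ← EReal.coe_add]
  congr 1
  rw [ip_sub_left, ip_comm Sn, ip_comm Shat] at h
  rw [ip_sub_right, ip_comm P]
  linarith

end EClass

/-- closed-form Bregman estimator for Jordan algebras. Suppose
`F ∈ 𝓔^m` has the form `F(Σ) = tr(φ(Σ))` on `S^m_+` with `φ` analytic on `(0,∞)`,
gradient `∇F(Σ) = φ'(Σ)`, and `𝕃^m_+` open in `S^m`. Let `𝓛 ⊆ S^m` be a Jordan-algebra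
linear subspace containing `I_m` and `S_n ∈ S^m`. If the orthogonal projection `Σ̂` of
`S_n` onto `𝓛` (w.r.t. the trace inner product) is positive definite, then
`L̂ := ∇F(Σ̂)` is the unique maximizer of `g_n(L) = −F*(L) + ⟨L,S_n⟩` over
`𝓛 ∩ 𝕃^m_+`. -/
theorem jordan_algebra_closed_form {m : ℕ} (E : EClass m) (φ : ℝ → ℝ)
    (hφ : AnalyticOnNhd ℝ φ (Set.Ioi 0))
    (hF : ∀ P : Mat m, P.PosDef → E.F P = ((matApply φ P).trace : EReal))
    (hgrad : ∀ P : Mat m, P.PosDef → E.grad P = matApply (deriv φ) P)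
    (hopen : RelOpen (Lplus E))
    (L : Submodule ℝ (Mat m)) (hLsym : ∀ A ∈ L, Matrix.IsHermitian A)
    (hJordan : ∀ A B : Mat m, A ∈ L → B ∈ L → ((1 : ℝ) / 2) • (A * B + B * A) ∈ L)
    (hI : (1 : Mat m) ∈ L)
    (Sn : Mat m) (hSn : Sn.IsHermitian)
    (Shat : Mat m) (hproj : Shat ∈ L ∧ ∀ U ∈ L, ip (Sn - Shat) U = 0)
    (hpd : Shat.PosDef) :
    E.grad Shat ∈ (L : Set (Mat m)) ∩ Lplus E ∧
      IsMaxOn (gn E Sn) ((L : Set (Mat m)) ∩ Lplus E) (E.grad Shat) ∧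
      ∀ L' ∈ (L : Set (Mat m)) ∩ Lplus E,
        IsMaxOn (gn E Sn) ((L : Set (Mat m)) ∩ Lplus E) L' → L' = E.grad Shat := by
  have hmem : E.grad Shat ∈ L := by
    obtain ⟨p, hp⟩ := exists_matApply_eq_aeval (deriv φ) hpd.isHermitian
    rw [hgrad Shat hpd, hp]
    exact aeval_mem_of_jordan hJordan hI hproj.1 p
  have hself : E.grad Shat ∈ (L : Set (Mat m)) ∩ Lplus E := ⟨hmem, Shat, hpd, rfl⟩
  have hval : gn E Sn (E.grad Shat) = ((E.F Shat).toReal : EReal) := by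
    rw [E.gn_grad hpd (hproj.2 _ hmem), sub_self]
    simp [ip]
  refine ⟨hself, ?_, ?_⟩
  · rintro _ ⟨hK, P, hP, rfl⟩
    rw [Set.mem_ofPred_eq, hval, E.gn_grad hP (hproj.2 _ hK)]
    exact EReal.coe_le_coe (E.add_ip_grad_le hP hpd.isHermitian (E.posDef_mem_dom _ hpd))
  · rintro _ ⟨hK, P, hP, rfl⟩ hmax
    by_contra hne
    have hle := isMaxOn_iff.mp hmax _ hself
    rw [hval, E.gn_grad hP (hproj.2 _ hK)] at hle
    have hlt := E.add_ip_grad_lt hP hpd fun h => hne (congrArg E.grad h)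
    exact (EReal.coe_le_coe_iff.mp hle).not_gt hlt

end Entropic
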